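/- (Theorem 2.) Let π_n, π_{n+1}, η_n be policies with E_{s∼d_{π_n}}[D_TV(π_{n+1}(·|s), π_n(·|s))] ≤ β for some β ≥ 0. Define ε = max_{s∈S} |E_{a∼π_{n+1}(·|s)}[A^{η_n}(s,a)]|, 𝔸_n(π_{n+1}) = E_{s∼d_{π_n}}[E_{a∼π_{n+1}(·|s)}[A^{η_n}(s,a)]], and Δ_n = J(π_n) − J(η_n). If 𝔸_n(π_{n+1}) ≤ 0, then J(π_{n+1}) − J(π_n) ≤ 2βε/(1−γ)² − |𝔸_n(π_{n+1})|/(1−γ) − Δ_n. -/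

import Mathlib

open scoped BigOperators

noncomputable section

/-- `p` is a probability distribution on a finite type. -/
def IsDist {X : Type*} [Fintype X] (p : X → ℝ) : Prop :=
  (∀ x, 0 ≤ p x) ∧ ∑ x, p x = 1

/-- `P` is a transition dynamics: `P s a` is a distribution over next states. -/
def IsDynamics {S A : Type*} [Fintype S] (P : S → A → S → ℝ) : Prop :=
  ∀ s a, IsDist (P s a)

/-- `π` is a (stochastic) policy: `π s` is a distribution over actions. -/
def IsPolicy {S A : Type*} [Fintype A] (π : S → A → ℝ) : Prop :=
  ∀ s, IsDist (π s)

/-- One-step evolution of a state distribution under policy `π` and dynamics `P`. -/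
def step {S A : Type*} [Fintype S] [Fintype A]
    (P : S → A → S → ℝ) (π : S → A → ℝ) (d : S → ℝ) : S → ℝ :=
  fun s' => ∑ s, ∑ a, d s * π s a * P s a s'

/-- The time-`t` state distribution `d_π^t` starting from `ρ₀`. -/
def stateDist {S A : Type*} [Fintype S] [Fintype A]
    (P : S → A → S → ℝ) (π : S → A → ℝ) (ρ₀ : S → ℝ) : ℕ → S → ℝ
  | 0 => ρ₀
  | t + 1 => step P π (stateDist P π ρ₀ t)

/-- Discounted state visitation distribution `d_π = (1-γ) Σ_t γ^t d_π^t`. -/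
def visit {S A : Type*} [Fintype S] [Fintype A]
    (γ : ℝ) (P : S → A → S → ℝ) (π : S → A → ℝ) (ρ₀ : S → ℝ) : S → ℝ :=
  fun s => (1 - γ) * ∑' t : ℕ, γ ^ t * stateDist P π ρ₀ t s

/-- Expected cost of one step when the state is distributed as `d` and actions follow `π`. -/
def expCost {S A : Type*} [Fintype S] [Fintype A]
    (c : S → A → ℝ) (π : S → A → ℝ) (d : S → ℝ) : ℝ :=
  ∑ s, ∑ a, d s * π s a * c s a

/-- Value function `V^π(s₀)`: expected total discounted cost starting at `s₀`. -/
def Vf {S A : Type*} [Fintype S] [Fintype A] [DecidableEq S]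
    (γ : ℝ) (P : S → A → S → ℝ) (c : S → A → ℝ) (π : S → A → ℝ) (s₀ : S) : ℝ :=
  ∑' t : ℕ, γ ^ t * expCost c π (stateDist P π (fun s => if s = s₀ then 1 else 0) t)

/-- Objective `J(π) = E_{s∼ρ₀}[V^π(s)]`. -/
def Jf {S A : Type*} [Fintype S] [Fintype A] [DecidableEq S]
    (γ : ℝ) (P : S → A → S → ℝ) (c : S → A → ℝ) (ρ₀ : S → ℝ) (π : S → A → ℝ) : ℝ :=
  ∑ s, ρ₀ s * Vf γ P c π s

/-- State-action value `Q^π(s,a) = c(s,a) + γ E_{s'∼P_{s,a}}[V^π(s')]`. -/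
def Qf {S A : Type*} [Fintype S] [Fintype A] [DecidableEq S]
    (γ : ℝ) (P : S → A → S → ℝ) (c : S → A → ℝ) (π : S → A → ℝ) (s : S) (a : A) : ℝ :=
  c s a + γ * ∑ s', P s a s' * Vf γ P c π s'

/-- Disadvantage function `A^π(s,a) = Q^π(s,a) - V^π(s)`. -/
def Adv {S A : Type*} [Fintype S] [Fintype A] [DecidableEq S]
    (γ : ℝ) (P : S → A → S → ℝ) (c : S → A → ℝ) (π : S → A → ℝ) (s : S) (a : A) : ℝ :=
  Qf γ P c π s a - Vf γ P c π s

theorem sum_step {S A : Type*} [Fintype S] [Fintype A] (P : S → A → S → ℝ)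
    (π : S → A → ℝ) (d v : S → ℝ) :
    ∑ s', step P π d s' * v s' = ∑ s, d s * ∑ a, π s a * ∑ s', P s a s' * v s' := by
  simp only [step, Finset.mul_sum, Finset.sum_mul]
  rw [Finset.sum_comm]
  refine Finset.sum_congr rfl fun _ _ => ?_
  rw [Finset.sum_comm]
  exact Finset.sum_congr rfl fun _ _ => Finset.sum_congr rfl fun _ _ => by ring

theorem IsDist.step {S A : Type*} [Fintype S] [Fintype A] {P : S → A → S → ℝ}
    {π : S → A → ℝ} {d : S → ℝ} (hd : IsDist d) (hP : IsDynamics P) (hπ : IsPolicy π) :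
    IsDist (step P π d) := by
  refine ⟨fun s' => Finset.sum_nonneg fun s _ => Finset.sum_nonneg fun a _ =>
    mul_nonneg (mul_nonneg (hd.1 s) ((hπ s).1 a)) ((hP s a).1 s'), ?_⟩
  simpa [(hP _ _).2, (hπ _).2, hd.2] using sum_step P π d fun _ => 1

theorem IsDist.stateDist {S A : Type*} [Fintype S] [Fintype A] {P : S → A → S → ℝ}
    {π : S → A → ℝ} {ρ : S → ℝ} (hρ : IsDist ρ) (hP : IsDynamics P) (hπ : IsPolicy π) (t : ℕ) :
    IsDist (stateDist P π ρ t) := by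
  induction t with
  | zero => exact hρ
  | succ t ih => exact ih.step hP hπ

theorem isDist_single {S : Type*} [Fintype S] [DecidableEq S] (s₀ : S) :
    IsDist (fun s => if s = s₀ then (1 : ℝ) else 0) :=
  ⟨fun s => by dsimp only; split_ifs <;> norm_num, by simp⟩

theorem IsDist.le_one {X : Type*} [Fintype X] {p : X → ℝ} (hp : IsDist p) (x : X) : p x ≤ 1 :=
  hp.2 ▸ Finset.single_le_sum (fun y _ => hp.1 y) (Finset.mem_univ x)

theorem summable_discounted_stateDist {S A : Type*} [Fintype S] [Fintype A]
    {P : S → A → S → ℝ} {π : S → A → ℝ} {ρ : S → ℝ} {γ : ℝ} (hγ : 0 ≤ γ) (hγ' : γ < 1)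
    (hρ : IsDist ρ) (hP : IsDynamics P) (hπ : IsPolicy π) (s : S) :
    Summable fun t : ℕ => γ ^ t * stateDist P π ρ t s := by
  refine Summable.of_nonneg_of_le
    (fun t => mul_nonneg (pow_nonneg hγ t) ((hρ.stateDist hP hπ t).1 s))
    (fun t => ?_) (summable_geometric_of_lt_one hγ hγ')
  exact mul_le_of_le_one_right (pow_nonneg hγ t) ((hρ.stateDist hP hπ t).le_one s)

theorem visit_nonneg {S A : Type*} [Fintype S] [Fintype A]
    {P : S → A → S → ℝ} {π : S → A → ℝ} {ρ : S → ℝ} {γ : ℝ} (hγ : 0 ≤ γ) (hγ' : γ < 1)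
    (hρ : IsDist ρ) (hP : IsDynamics P) (hπ : IsPolicy π) (s : S) :
    0 ≤ visit γ P π ρ s :=
  mul_nonneg (by linarith) (tsum_nonneg fun t =>
    mul_nonneg (pow_nonneg hγ t) ((hρ.stateDist hP hπ t).1 s))

/-- Integrating a function against the visitation distribution. -/
theorem sum_visit_mul {S A : Type*} [Fintype S] [Fintype A]
    {P : S → A → S → ℝ} {π : S → A → ℝ} {ρ : S → ℝ} {γ : ℝ} (hγ : 0 ≤ γ) (hγ' : γ < 1)
    (hρ : IsDist ρ) (hP : IsDynamics P) (hπ : IsPolicy π) (v : S → ℝ) :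
    ∑ s, visit γ P π ρ s * v s =
      (1 - γ) * ∑' t : ℕ, γ ^ t * ∑ s, stateDist P π ρ t s * v s := by
  have h := fun s => (summable_discounted_stateDist hγ hγ' hρ hP hπ s).mul_right (v s)
  simp only [visit, Finset.mul_sum, ← mul_assoc (γ ^ _)]
  rw [Summable.tsum_finsetSum fun s _ => h s, Finset.mul_sum]
  exact Finset.sum_congr rfl fun s _ => by rw [tsum_mul_right, mul_assoc]

/-- The Bellman flow equation for the visitation distribution. -/
theorem visit_eq {S A : Type*} [Fintype S] [Fintype A]
    {P : S → A → S → ℝ} {π : S → A → ℝ} {ρ : S → ℝ} {γ : ℝ} (hγ : 0 ≤ γ) (hγ' : γ < 1)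
    (hρ : IsDist ρ) (hP : IsDynamics P) (hπ : IsPolicy π) (s : S) :
    visit γ P π ρ s = (1 - γ) * ρ s + γ * step P π (visit γ P π ρ) s := by
  have hstep : ∀ d : S → ℝ, step P π d s = ∑ x, d x * ∑ a, π x a * P x a s := fun d => by
    simp only [step, Finset.mul_sum, mul_assoc]
  rw [hstep, sum_visit_mul hγ hγ' hρ hP hπ, visit,
    (summable_discounted_stateDist hγ hγ' hρ hP hπ s).tsum_eq_zero_add]
  simp only [← hstep, stateDist, pow_succ', mul_assoc γ, tsum_mul_left]
  ring

theorem stateDist_eq_sum_single {S A : Type*} [Fintype S] [Fintype A] [DecidableEq S]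
    (P : S → A → S → ℝ) (π : S → A → ℝ) (ρ : S → ℝ) (t : ℕ) (s' : S) :
    stateDist P π ρ t s' =
      ∑ s₀, ρ s₀ * stateDist P π (fun s => if s = s₀ then 1 else 0) t s' := by
  induction t generalizing s' with
  | zero => simp [stateDist]
  | succ t ih =>
    simp only [stateDist, step, ih, Finset.mul_sum, Finset.sum_mul]
    rw [Finset.sum_comm_cycle]
    simp only [mul_assoc]

/-- The objective is the expected cost under the visitation distribution, up to `1 - γ`. -/
theorem expCost_visit {S A : Type*} [Fintype S] [Fintype A] [DecidableEq S]
    {P : S → A → S → ℝ} {π : S → A → ℝ} {ρ : S → ℝ} {γ : ℝ} (hγ : 0 ≤ γ) (hγ' : γ < 1)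
    (hρ : IsDist ρ) (hP : IsDynamics P) (hπ : IsPolicy π) (c : S → A → ℝ) :
    expCost c π (visit γ P π ρ) = (1 - γ) * Jf γ P c ρ π := by
  have hcost : ∀ d : S → ℝ, expCost c π d = ∑ s, d s * ∑ a, π s a * c s a := fun d => by
    simp only [expCost, Finset.mul_sum, mul_assoc]
  have hsum : ∀ s₀, Summable fun t : ℕ => γ ^ t * ∑ s,
      stateDist P π (fun s => if s = s₀ then 1 else 0) t s * ∑ a, π s a * c s a := fun s₀ => by
    simp only [Finset.mul_sum (s := (Finset.univ : Finset S)), ← mul_assoc (γ ^ _)]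
    exact summable_sum fun s _ =>
      (summable_discounted_stateDist hγ hγ' (isDist_single s₀) hP hπ s).mul_right _
  rw [hcost, sum_visit_mul hγ hγ' hρ hP hπ]
  simp only [Jf, Vf, hcost, ← tsum_mul_left (a := ρ _)]
  rw [← Summable.tsum_finsetSum fun s _ => (hsum s).mul_left (ρ s)]
  congr 1
  refine tsum_congr fun t => ?_
  rw [Finset.sum_congr rfl fun s _ => by rw [stateDist_eq_sum_single P π ρ t s, Finset.sum_mul],
    Finset.sum_comm, Finset.mul_sum]
  refine Finset.sum_congr rfl fun s _ => ?_
  simp only [mul_assoc, ← Finset.mul_sum]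
  ring

/-- The performance difference lemma. -/
theorem sum_visit_mul_adv {S A : Type*} [Fintype S] [Fintype A] [DecidableEq S]
    {P : S → A → S → ℝ} {π : S → A → ℝ} {ρ : S → ℝ} {γ : ℝ} (hγ : 0 ≤ γ) (hγ' : γ < 1)
    (hρ : IsDist ρ) (hP : IsDynamics P) (hπ : IsPolicy π) (c : S → A → ℝ) (η : S → A → ℝ) :
    ∑ s, visit γ P π ρ s * ∑ a, π s a * Adv γ P c η s a =
      (1 - γ) * (Jf γ P c ρ π - Jf γ P c ρ η) := by
  have hflow : ∑ s, visit γ P π ρ s * Vf γ P c η s = (1 - γ) * Jf γ P c ρ η +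
      γ * ∑ s, step P π (visit γ P π ρ) s * Vf γ P c η s := by
    simp only [Jf, Finset.mul_sum, ← Finset.sum_add_distrib]
    refine Finset.sum_congr rfl fun s _ => ?_
    conv_lhs => rw [visit_eq hγ hγ' hρ hP hπ s]
    ring
  have hadv : ∀ s, ∑ a, π s a * Adv γ P c η s a = ∑ a, π s a * c s a +
      γ * (∑ a, π s a * ∑ s', P s a s' * Vf γ P c η s') - Vf γ P c η s := fun s => by
    have h : Vf γ P c η s = ∑ a, π s a * Vf γ P c η s := by
      rw [← Finset.sum_mul, (hπ s).2, one_mul]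
    conv_rhs => rw [h]
    rw [Finset.mul_sum, ← Finset.sum_add_distrib, ← Finset.sum_sub_distrib]
    exact Finset.sum_congr rfl fun a _ => by simp only [Adv, Qf]; ring
  have hcost : expCost c π (visit γ P π ρ) = ∑ s, visit γ P π ρ s * ∑ a, π s a * c s a := by
    simp only [expCost, Finset.mul_sum, mul_assoc]
  rw [sum_step] at hflow
  simp only [hadv, mul_sub, mul_add, Finset.sum_sub_distrib, Finset.sum_add_distrib]
  rw [← hcost, expCost_visit hγ hγ' hρ hP hπ, hflow, Finset.mul_sum]
  simp only [mul_left_comm γ]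
  ring

theorem sum_abs_sum_mul_le {S A : Type*} [Fintype S] [Fintype A] {P : S → A → S → ℝ}
    (hP : IsDynamics P) (w : S → A → ℝ) :
    ∑ s', |∑ s, ∑ a, w s a * P s a s'| ≤ ∑ s, ∑ a, |w s a| := by
  calc ∑ s', |∑ s, ∑ a, w s a * P s a s'|
      ≤ ∑ s', ∑ s, ∑ a, |w s a| * P s a s' := by
        refine Finset.sum_le_sum fun s' _ => (Finset.abs_sum_le_sum_abs _ _).trans
          (Finset.sum_le_sum fun s _ => (Finset.abs_sum_le_sum_abs _ _).trans_eq
            (Finset.sum_congr rfl fun a _ => ?_))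
        rw [abs_mul, abs_of_nonneg ((hP s a).1 s')]
    _ = ∑ s, ∑ a, |w s a| := by
        rw [Finset.sum_comm]
        refine Finset.sum_congr rfl fun s _ => ?_
        rw [Finset.sum_comm]
        simp only [← Finset.mul_sum, (hP _ _).2, mul_one]

/-- The visitation distributions of two policies are close in `ℓ¹` when the policies are. -/
theorem sum_abs_visit_sub_le {S A : Type*} [Fintype S] [Fintype A]
    {P : S → A → S → ℝ} {π π' : S → A → ℝ} {ρ : S → ℝ} {γ : ℝ} (hγ : 0 ≤ γ) (hγ' : γ < 1)
    (hρ : IsDist ρ) (hP : IsDynamics P) (hπ : IsPolicy π) (hπ' : IsPolicy π') :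
    (1 - γ) * ∑ s, |visit γ P π' ρ s - visit γ P π ρ s| ≤
      γ * ∑ s, visit γ P π ρ s * ∑ a, |π' s a - π s a| := by
  set d := visit γ P π ρ
  set d' := visit γ P π' ρ
  have hnn : ∀ s, 0 ≤ d s := visit_nonneg hγ hγ' hρ hP hπ
  have hdiff : ∀ s, d' s - d s = γ * (∑ x, ∑ a, ((d' x - d x) * π' x a) * P x a s +
      ∑ x, ∑ a, (d x * (π' x a - π x a)) * P x a s) := fun s => by
    have h : ∑ x, ∑ a, ((d' x - d x) * π' x a) * P x a s +
        ∑ x, ∑ a, (d x * (π' x a - π x a)) * P x a s = step P π' d' s - step P π d s := by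
      simp only [step, ← Finset.sum_add_distrib, ← Finset.sum_sub_distrib]
      exact Finset.sum_congr rfl fun _ _ => Finset.sum_congr rfl fun _ _ => by ring
    rw [h]
    linarith [visit_eq hγ hγ' hρ hP hπ s, visit_eq hγ hγ' hρ hP hπ' s]
  have h1 := sum_abs_sum_mul_le hP fun x a => (d' x - d x) * π' x a
  have h2 := sum_abs_sum_mul_le hP fun x a => d x * (π' x a - π x a)
  simp only [abs_mul, abs_of_nonneg ((hπ' _).1 _), abs_of_nonneg (hnn _), ← Finset.mul_sum,
    (hπ' _).2, mul_one] at h1 h2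
  have h3 : ∑ s, |d' s - d s| ≤
      γ * (∑ s, |d' s - d s| + ∑ s, d s * ∑ a, |π' s a - π s a|) := by
    calc ∑ s, |d' s - d s|
        ≤ ∑ s, γ * (|∑ x, ∑ a, ((d' x - d x) * π' x a) * P x a s| +
            |∑ x, ∑ a, (d x * (π' x a - π x a)) * P x a s|) :=
          Finset.sum_le_sum fun s _ => by
            conv_lhs => rw [hdiff s, abs_mul, abs_of_nonneg hγ]
            exact mul_le_mul_of_nonneg_left (abs_add_le _ _) hγ
      _ ≤ _ := by
          rw [← Finset.mul_sum, Finset.sum_add_distrib]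
          exact mul_le_mul_of_nonneg_left (add_le_add h1 h2) hγ
  linarith

/-- **Theorem 2.** If `E_{s∼d_{π_n}}[D_TV(π_{n+1}(·|s), π_n(·|s))] ≤ β` and
`𝔸_n(π_{n+1}) ≤ 0`, then with `ε = max_s |E_{a∼π_{n+1}(·|s)}[A^{η_n}(s,a)]|` and
`Δ_n = J(π_n) - J(η_n)`, one has
`J(π_{n+1}) - J(π_n) ≤ 2βε/(1-γ)² - |𝔸_n(π_{n+1})|/(1-γ) - Δ_n`. -/
theorem dpi_theorem_two
    {S A : Type*} [Fintype S] [Fintype A] [Nonempty S] [DecidableEq S]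
    (γ : ℝ) (P : S → A → S → ℝ) (c : S → A → ℝ) (ρ₀ : S → ℝ)
    (hγ : 0 < γ) (hγ' : γ < 1) (hP : IsDynamics P) (hρ : IsDist ρ₀)
    (hc : ∀ s a, 0 ≤ c s a ∧ c s a ≤ 1)
    (πn πnext ηn : S → A → ℝ)
    (hπn : IsPolicy πn) (hπnext : IsPolicy πnext) (hηn : IsPolicy ηn)
    (β : ℝ) (hβ : 0 ≤ β)
    (htv : ∑ s, visit γ P πn ρ₀ s * ((∑ a, |πnext s a - πn s a|) / 2) ≤ β)
    (hA : ∑ s, visit γ P πn ρ₀ s * ∑ a, πnext s a * Adv γ P c ηn s a ≤ 0) :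
    Jf γ P c ρ₀ πnext - Jf γ P c ρ₀ πn ≤
      2 * β * (⨆ s : S, |∑ a, πnext s a * Adv γ P c ηn s a|) / (1 - γ) ^ 2 -
        |∑ s, visit γ P πn ρ₀ s * ∑ a, πnext s a * Adv γ P c ηn s a| / (1 - γ) -
        (Jf γ P c ρ₀ πn - Jf γ P c ρ₀ ηn) := by
  set f : S → ℝ := fun s => ∑ a, πnext s a * Adv γ P c ηn s a
  set ε : ℝ := ⨆ s : S, |f s|
  have hε : ∀ s, |f s| ≤ ε := fun s => le_ciSup (Finite.bddAbove_range fun s => |f s|) s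
  have hε0 : 0 ≤ ε := (abs_nonneg _).trans (hε (Classical.arbitrary S))
  have hpos : 0 < 1 - γ := by linarith
  have hpd := sum_visit_mul_adv hγ.le hγ' hρ hP hπnext c ηn
  have hl1 := sum_abs_visit_sub_le hγ.le hγ' hρ hP hπn hπnext
  simp only [← mul_div_assoc, ← Finset.sum_div] at htv
  set D := ∑ s, |visit γ P πnext ρ₀ s - visit γ P πn ρ₀ s|
  set M := ∑ s, visit γ P πn ρ₀ s * f s with hM
  have hD : (1 - γ) * D ≤ 2 * β := by
    have : γ * (∑ s, visit γ P πn ρ₀ s * ∑ a, |πnext s a - πn s a|) ≤ γ * (2 * β) :=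
      mul_le_mul_of_nonneg_left (by linarith) hγ.le
    nlinarith
  have hshift : ∑ s, visit γ P πnext ρ₀ s * f s - M ≤ D * ε := by
    rw [hM, ← Finset.sum_sub_distrib, Finset.sum_mul]
    refine Finset.sum_le_sum fun s _ => ?_
    rw [← sub_mul]
    exact (le_abs_self _).trans
      ((abs_mul _ _).trans_le (mul_le_mul_of_nonneg_left (hε s) (abs_nonneg _)))
  have hbound : (1 - γ) ^ 2 * (Jf γ P c ρ₀ πnext - Jf γ P c ρ₀ ηn) ≤
      2 * β * ε + (1 - γ) * M := by
    have h1 : (1 - γ) * ((1 - γ) * (Jf γ P c ρ₀ πnext - Jf γ P c ρ₀ ηn)) ≤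
        (1 - γ) * (M + D * ε) := mul_le_mul_of_nonneg_left (by linarith) hpos.le
    have h2 : (1 - γ) * D * ε ≤ 2 * β * ε := mul_le_mul_of_nonneg_right hD hε0
    linarith
  rw [abs_of_nonpos hA]
  have hfinal : Jf γ P c ρ₀ πnext - Jf γ P c ρ₀ ηn ≤
      2 * β * ε / (1 - γ) ^ 2 - -M / (1 - γ) := by
    have : 2 * β * ε / (1 - γ) ^ 2 - -M / (1 - γ) =
        (2 * β * ε + (1 - γ) * M) / (1 - γ) ^ 2 := by
      field_simp
      ring
    rw [this, le_div_iff₀ (by positivity)]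
    linarith
  linarith
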